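/- If X is a compact set in C^n and u in PSH(X), then u(z) <= sup over w in B_X of u(w), for all z in X. -/

import Mathlib

open MeasureTheory Metric Filter Topology Set Complex
open scoped ENNReal

noncomputable section

/-- `ℂⁿ`. -/
abbrev En (n : ℕ) : Type := EuclideanSpace ℂ (Fin n)

instance (n : ℕ) : MeasurableSpace (En n) := borel _

instance (n : ℕ) : BorelSpace (En n) := ⟨rfl⟩

open Classical in
/-- The positive part of an extended real number, as an element of `ℝ≥0∞`. -/
def epos (x : EReal) : ℝ≥0∞ := if x = ⊤ then ⊤ else ENNReal.ofReal x.toReal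

/-- The integral of an `EReal`-valued function `u` against a measure `μ`, defined as the
difference of the lower integrals of the positive and negative parts of `u`. -/
def eint {α : Type*} [MeasurableSpace α] (μ : Measure α) (u : α → EReal) : EReal :=
  ((∫⁻ x, epos (u x) ∂μ : ℝ≥0∞) : EReal) - ((∫⁻ x, epos (-(u x)) ∂μ : ℝ≥0∞) : EReal)

/-- The normalized angular measure `(2π)⁻¹ dθ` on `[0, 2π)`. -/
def thetaM : Measure ℝ :=
  (ENNReal.ofReal ((2 * Real.pi)⁻¹)) • (volume.restrict (Set.Ico (0 : ℝ) (2 * Real.pi)))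

/-- A function `u` with values in `[-∞, ∞)` is plurisubharmonic on an open set `U ⊆ ℂⁿ`:
it is upper semicontinuous, `< ⊤`, and satisfies the sub-mean-value inequality on every
complex line. -/
def PshOnE {n : ℕ} (u : En n → EReal) (U : Set (En n)) : Prop :=
  UpperSemicontinuousOn u U ∧ (∀ z ∈ U, u z < ⊤) ∧
  ∀ z ∈ U, ∀ w : En n, ∀ r : ℝ, 0 < r →
    (∀ ζ : ℂ, ‖ζ‖ ≤ r → z + ζ • w ∈ U) →
    u z ≤ eint thetaM (fun θ => u (z + (circleMap 0 r θ) • w))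

/-- `μ` is a Jensen measure on `X` with barycenter `z`:  a Borel probability measure
supported on `X` such that `u z ≤ ∫ u dμ` for every function `u` continuous and
plurisubharmonic on some open neighborhood of `X`. -/
def IsJensen {n : ℕ} (X : Set (En n)) (z : En n) (μ : Measure (En n)) : Prop :=
  IsProbabilityMeasure μ ∧ μ Xᶜ = 0 ∧
  ∀ U : Set (En n), IsOpen U → X ⊆ U →
    ∀ u : En n → EReal, ContinuousOn u U → PshOnE u U → u z ≤ eint μ u

/-- `u : X → [-∞, ∞)` is plurisubharmonic on the compact set `X` : it is upper
semicontinuous on `X`, `< ⊤` on `X`, and satisfies the subaveraging inequality with respect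
to all Jensen measures on `X`. -/
def PSHe {n : ℕ} (X : Set (En n)) (u : En n → EReal) : Prop :=
  UpperSemicontinuousOn u X ∧ (∀ z ∈ X, u z < ⊤) ∧
  ∀ z ∈ X, ∀ μ : Measure (En n), IsJensen X z μ → u z ≤ eint μ u

/-- `PSH^c(X)`: continuous plurisubharmonic functions on `X`. -/
def PSHce {n : ℕ} (X : Set (En n)) (u : En n → EReal) : Prop :=
  PSHe X u ∧ ContinuousOn u X

/-- Real-valued continuous plurisubharmonic functions on `X`. -/
def PSHcR {n : ℕ} (X : Set (En n)) (u : En n → ℝ) : Prop :=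
  ContinuousOn u X ∧ PSHe X (fun x => (u x : EReal))

/-- `O_X`: the set of points `z ∈ X` whose only Jensen measure is `δ_z`. -/
def Oset {n : ℕ} (X : Set (En n)) : Set (En n) :=
  {z | z ∈ X ∧ ∀ μ : Measure (En n), IsJensen X z μ → μ = Measure.dirac z}

/-- The potential boundary `B_X`, the closure of `O_X`. -/
def Bset {n : ℕ} (X : Set (En n)) : Set (En n) := closure (Oset X)

/-- `J^b_z(X)`: Jensen measures with barycenter `z` supported on `B_X`. -/
def IsJensenB {n : ℕ} (X : Set (En n)) (z : En n) (μ : Measure (En n)) : Prop :=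
  IsJensen X z μ ∧ μ (Bset X)ᶜ = 0

/-- `ν` is subordinated to `μ` : `μ(u) ≥ ν(u)` for all `u ∈ PSH^c(X)`. -/
def Subord {n : ℕ} (X : Set (En n)) (μ ν : Measure (En n)) : Prop :=
  ∀ u : En n → EReal, PSHce X u → eint ν u ≤ eint μ u

/-- Subharmonic functions with values in `[-∞, ∞)` on an open set `U ⊆ ℂ`. -/
def SubharmOn (u : ℂ → EReal) (U : Set ℂ) : Prop :=
  UpperSemicontinuousOn u U ∧ (∀ z ∈ U, u z < ⊤) ∧
  ∀ z ∈ U, ∀ r : ℝ, 0 < r → closedBall z r ⊆ U →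
    u z ≤ eint thetaM (fun θ => u (circleMap z r θ))

/-- Harmonic (real-valued) functions on an open set `U ⊆ ℂ`: continuous functions
satisfying the mean-value equality. -/
def HarmOn (h : ℂ → ℝ) (U : Set ℂ) : Prop :=
  ContinuousOn h U ∧
  ∀ z ∈ U, ∀ r : ℝ, 0 < r → closedBall z r ⊆ U →
    h z = (2 * Real.pi)⁻¹ * ∫ θ in (0 : ℝ)..(2 * Real.pi), h (circleMap z r θ)

/-- Superharmonic (real-valued) functions on an open set `U ⊆ ℂ`. -/
def SuperharmOn (v : ℂ → ℝ) (U : Set ℂ) : Prop :=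
  LowerSemicontinuousOn v U ∧
  ∀ z ∈ U, ∀ r : ℝ, 0 < r → closedBall z r ⊆ U →
    (2 * Real.pi)⁻¹ * (∫ θ in (0 : ℝ)..(2 * Real.pi), v (circleMap z r θ)) ≤ v z

/-- The infimum of all positive superharmonic functions on the unit disk, extending
continuously to the closed disk and `≥ 1` on `A`, evaluated at `z`. -/
def hmPre (A : Set ℂ) (z : ℂ) : ℝ :=
  sInf {t : ℝ | ∃ v : ℂ → ℝ, SuperharmOn v (ball 0 1) ∧ (∀ w ∈ ball (0 : ℂ) 1, 0 < v w) ∧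
    ContinuousOn v (closedBall 0 1) ∧ (∀ w ∈ A, 1 ≤ v w) ∧ t = v z}

/-- The harmonic measure `ω(z, A, 𝔻)` of `A` with respect to the unit disk. -/
def hm (z : ℂ) (A : Set ℂ) : ℝ := Filter.liminf (fun w => hmPre A w) (𝓝 z)

open Classical in
/-- The radial limit of a map `f` at the boundary point `ζ` of the unit circle
(junk value `0` if the radial limit does not exist). -/
def bval {n : ℕ} (f : ℂ → En n) (ζ : ℂ) : En n :=
  if h : ∃ l : En n, Tendsto (fun r : ℝ => f ((r : ℂ) * ζ)) (𝓝[<] (1 : ℝ)) (𝓝 l)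
  then h.choose else 0

open Classical in
/-- The radial limit of an `EReal`-valued function on the disk at the boundary point `ζ`. -/
def bvalE (g : ℂ → EReal) (ζ : ℂ) : EReal :=
  if h : ∃ l : EReal, Tendsto (fun r : ℝ => g ((r : ℂ) * ζ)) (𝓝[<] (1 : ℝ)) (𝓝 l)
  then h.choose else 0

/-- `μ_f`: the push-forward of the normalized arclength measure on the unit circle under the
radial boundary values of `f`. -/
def bmeas {n : ℕ} (f : ℂ → En n) : Measure (En n) :=
  thetaM.map (fun θ => bval f (circleMap 0 1 θ))

/-- Weak-* convergence of a sequence of measures on `ℂⁿ`. -/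
def WeakConv {n : ℕ} (μs : ℕ → Measure (En n)) (μ : Measure (En n)) : Prop :=
  ∀ φ : BoundedContinuousFunction (En n) ℝ,
    Tendsto (fun j => ∫ x, φ x ∂(μs j)) atTop (𝓝 (∫ x, φ x ∂μ))

/-- The cluster set `cl L` of a sequence of maps of the unit disk into `ℂⁿ`. -/
def clusterSet {n : ℕ} (f : ℕ → ℂ → En n) : Set (En n) :=
  {z | ∀ r : ℝ, 0 < r → ∀ N : ℕ, ∃ j, N ≤ j ∧ ∃ ζ ∈ ball (0 : ℂ) 1, f j ζ ∈ ball z r}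

/-- A point `z` is totally essential for the sequence `f` if for every open set `V ∋ z` the
harmonic measures at `0` of `f j ⁻¹' V` stay bounded away from `0`. -/
def TotallyEssential {n : ℕ} (f : ℕ → ℂ → En n) (z : En n) : Prop :=
  ∀ V : Set (En n), IsOpen V → z ∈ V →
    0 < Filter.atTop.liminf (fun j => hm 0 ((f j ⁻¹' V) ∩ ball 0 1))

/-- A totally perfect sequence `L` of holomorphic maps of the unit disk into `ℂⁿ`: a
uniformly bounded sequence of holomorphic maps which is weak-* converging (with limit measure
`μ_L` and center `z_L`) and all of whose cluster points are totally essential. -/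
structure PerfectSeq (n : ℕ) where
  f : ℕ → ℂ → En n
  holo : ∀ j, DifferentiableOn ℂ (f j) (ball 0 1)
  bdd : ∃ C : ℝ, ∀ j, ∀ ζ ∈ ball (0 : ℂ) 1, ‖f j ζ‖ ≤ C
  μL : Measure (En n)
  conv : WeakConv (fun j => bmeas (f j)) μL
  zL : En n
  center : Tendsto (fun j => f j 0) atTop (𝓝 zL)
  ess : ∀ z ∈ clusterSet f, TotallyEssential f z

/-- `J_z^s(L)`: the measures obtained as weak-* limits of `μ_{f_{j_k} ∘ g_k}` for subsequences
`{j_k}` and holomorphic maps `g_k : 𝔻 → 𝔻` with `f_{j_k}(g_k(0)) → z`. -/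
def JsSet {n : ℕ} (L : PerfectSeq n) (z : En n) : Set (Measure (En n)) :=
  {μ | ∃ jk : ℕ → ℕ, StrictMono jk ∧ ∃ g : ℕ → ℂ → ℂ,
    (∀ k, DifferentiableOn ℂ (g k) (ball 0 1) ∧ MapsTo (g k) (ball 0 1) (ball 0 1)) ∧
    WeakConv (fun k => bmeas ((L.f (jk k)) ∘ (g k))) μ ∧
    Tendsto (fun k => L.f (jk k) (g k 0)) atTop (𝓝 z)}

/-- `J_z(L)`: the convex hull of `J_z^s(L)`. -/
def JLSet {n : ℕ} (L : PerfectSeq n) (z : En n) : Set (Measure (En n)) :=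
  {μ | ∃ (m : ℕ) (w : Fin m → ℝ) (ν : Fin m → Measure (En n)),
    (∀ i, 0 ≤ w i) ∧ (∑ i, w i = 1) ∧ (∀ i, ν i ∈ JsSet L z) ∧
    μ = ∑ i, (ENNReal.ofReal (w i)) • ν i}

/-- `u` is harmonic on the totally perfect sequence `L`. -/
def HarmonicOnL {n : ℕ} (L : PerfectSeq n) (u : En n → EReal) : Prop :=
  PSHce (clusterSet L.f) u ∧
  ∀ z ∈ clusterSet L.f, ∀ μ ∈ JLSet L z, eint μ u = u z

/-- `PSH^w(X)`: weakly plurisubharmonic functions, the upper envelopes of nonempty families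
of continuous plurisubharmonic functions on `X`. -/
def PSHw {n : ℕ} (X : Set (En n)) (u : En n → EReal) : Prop :=
  ∃ F : Set (En n → EReal), F.Nonempty ∧ (∀ v ∈ F, PSHce X v) ∧
    ∀ x ∈ X, u x = ⨆ v ∈ F, v x

/-- `u` is maximal on `X ∖ Z`: for every relatively open `V ⊆ X ∖ Z` and every
`v ∈ PSH^c(closure V)`, if `v ≤ u` on the relative boundary of `V` in `X` then `v ≤ u`
on `closure V`. -/
def MaximalOn {n : ℕ} (X Z : Set (En n)) (u : En n → EReal) : Prop :=
  ∀ W : Set (En n), IsOpen W → X ∩ W ⊆ X \ Z →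
    ∀ v : En n → EReal, PSHce (closure (X ∩ W)) v →
      (∀ x ∈ closure (X ∩ W) \ (X ∩ W), v x ≤ u x) →
      ∀ x ∈ closure (X ∩ W), v x ≤ u x

/-- Pluriharmonic continuous real-valued functions on `X`. -/
def Pluriharm {n : ℕ} (X : Set (En n)) (h : En n → ℝ) : Prop :=
  ContinuousOn h X ∧
  ∀ z ∈ X, ∀ μ : Measure (En n), IsJensen X z μ → (h z : EReal) = eint μ (fun x => (h x : EReal))

/-- `X` is a Poisson set: every continuous real-valued function on `B_X` extends to a
pluriharmonic function on `X`. -/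
def PoissonSet {n : ℕ} (X : Set (En n)) : Prop :=
  ∀ φ : En n → ℝ, ContinuousOn φ (Bset X) →
    ∃ h : En n → ℝ, Pluriharm X h ∧ ∀ w ∈ Bset X, h w = φ w

end

theorem epos_mono : Monotone epos := by
  intro x y h
  unfold epos
  split_ifs with hx hy hy
  · exact le_rfl
  · exact absurd (top_le_iff.mp (hx ▸ h)) hy
  · exact le_top
  · rcases eq_or_ne x ⊥ with rfl | hb
    · simp
    · exact ENNReal.ofReal_le_ofReal (EReal.toReal_le_toReal h hb hy)

theorem eint_mono_ae {α : Type*} [MeasurableSpace α] {μ : Measure α} {u v : α → EReal}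
    (h : ∀ᵐ x ∂μ, u x ≤ v x) : eint μ u ≤ eint μ v := by
  refine EReal.sub_le_sub ?_ ?_
  · exact_mod_cast lintegral_mono_ae (h.mono fun x hx => epos_mono hx)
  · exact_mod_cast lintegral_mono_ae (h.mono fun x hx => epos_mono (EReal.neg_le_neg_iff.mpr hx))

theorem eint_coe {α : Type*} [MeasurableSpace α] {μ : Measure α} {g : α → ℝ}
    (hg : Integrable g μ) : eint μ (fun x => (g x : EReal)) = ((∫ x, g x ∂μ : ℝ) : EReal) := by
  have hpos : ∀ t : ℝ, epos (t : EReal) = ENNReal.ofReal t := fun t => by simp [epos]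
  have h1 : ∫⁻ x, ENNReal.ofReal (g x) ∂μ ≠ ⊤ := hg.lintegral_lt_top.ne
  have h2 : ∫⁻ x, ENNReal.ofReal (-g x) ∂μ ≠ ⊤ := hg.neg.lintegral_lt_top.ne
  rw [integral_eq_lintegral_pos_part_sub_lintegral_neg_part hg, EReal.coe_sub,
    EReal.coe_ennreal_toReal h1, EReal.coe_ennreal_toReal h2]
  simp only [eint, ← EReal.coe_neg, hpos]

/-- A function which is a.e. at most `M` and whose integral is at least `M` is a.e. equal to `M`. -/
theorem ae_eq_of_le_eint {α : Type*} [MeasurableSpace α] {μ : Measure α} [IsProbabilityMeasure μ]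
    {u : α → EReal} {M : ℝ} (hle : ∀ᵐ x ∂μ, u x ≤ M) (hM : (M : EReal) ≤ eint μ u)
    (hmeas : ∀ c : ℝ, NullMeasurableSet {x | u x < c} μ) : ∀ᵐ x ∂μ, u x = M := by
  have key : ∀ c : ℝ, c < M → μ {x | u x < c} = 0 := by
    intro c hc
    set S := {x | u x < (c : EReal)}
    have hint : Integrable (S.indicator fun _ => c - M) μ :=
      (integrable_const _).indicator₀ (hmeas c)
    have hle' : ∀ᵐ x ∂μ, u x ≤ ((M + S.indicator (fun _ => c - M) x : ℝ) : EReal) := by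
      filter_upwards [hle] with x hx
      by_cases hxS : x ∈ S
      · simpa [hxS] using (show u x < c from hxS).le
      · simpa [hxS] using hx
    have h := hM.trans (eint_mono_ae hle')
    rw [eint_coe (g := fun x => M + S.indicator (fun _ => c - M) x)
        ((integrable_const M).add hint), integral_add (integrable_const M) hint,
      integral_indicator₀ (hmeas c), EReal.coe_le_coe_iff] at h
    simp only [integral_const, probReal_univ, smul_eq_mul, measureReal_restrict_apply_univ] at h
    have h0 : μ.real S ≤ 0 := by nlinarith
    exact (measureReal_eq_zero_iff).mp (le_antisymm h0 measureReal_nonneg)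
  have hall : ∀ᵐ x ∂μ, ∀ q : ℚ, (q : ℝ) < M → ¬ u x < ((q : ℝ) : EReal) := by
    refine ae_all_iff.mpr fun q => ?_
    by_cases hq : (q : ℝ) < M
    · simpa [ae_iff, hq] using key q hq
    · simp [hq]
  filter_upwards [hle, hall] with x hx hq
  refine le_antisymm hx (le_of_not_gt fun hlt => ?_)
  obtain ⟨q, h1, h2⟩ := EReal.lt_iff_exists_rat_btwn.mp hlt
  exact hq q (by exact_mod_cast h2) (by exact_mod_cast h1)

theorem integral_thetaM_re (a b : ℂ) (r : ℝ) :
    ∫ θ, (a + circleMap 0 r θ * b).re ∂thetaM = a.re := by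
  have hd : ∀ θ : ℝ, HasDerivAt (fun θ : ℝ => (θ * a + circleMap 0 r θ * (-I * b)).re)
      (a + circleMap 0 r θ * b).re θ := by
    intro θ
    have h := (((hasDerivAt_id (θ : ℂ)).comp_ofReal).mul_const a).add
      ((hasDerivAt_circleMap 0 r θ).mul_const (-I * b))
    refine (reCLM.hasFDerivAt.comp_hasDerivAt θ h).congr_deriv ?_
    simp only [reCLM_apply, one_mul]
    congr 2
    linear_combination (-circleMap 0 r θ * b) * I_sq
  have hc : Continuous fun θ : ℝ => (a + circleMap 0 r θ * b).re := by fun_prop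
  rw [thetaM, integral_smul_measure, integral_Ico_eq_integral_Ioc,
    ← intervalIntegral.integral_of_le (by positivity),
    intervalIntegral.integral_eq_sub_of_hasDerivAt (fun θ _ => hd θ) (hc.intervalIntegrable _ _)]
  have hp : circleMap 0 r (2 * Real.pi) = circleMap 0 r 0 := by simp [circleMap]
  rw [hp, ENNReal.toReal_ofReal (by positivity)]
  simp
  field_simp

theorem integrable_thetaM {g : ℝ → ℝ} (hg : Continuous g) : Integrable g thetaM := by
  refine Integrable.smul_measure ?_ ENNReal.ofReal_ne_top
  exact (hg.integrableOn_Icc (a := 0) (b := 2 * Real.pi)).mono_set Ico_subset_Icc_self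

theorem pshOnE_re_inner {n : ℕ} (w : En n) :
    PshOnE (fun x => ((inner ℂ w x).re : EReal)) Set.univ := by
  have hcont : Continuous fun x : En n => ((inner ℂ w x).re : EReal) :=
    continuous_coe_real_ereal.comp (by fun_prop)
  refine ⟨hcont.upperSemicontinuous.upperSemicontinuousOn _, fun z _ => EReal.coe_lt_top _,
    fun z _ v r _ _ => ?_⟩
  simp only [inner_add_right, inner_smul_right]
  rw [eint_coe (integrable_thetaM (by fun_prop)), integral_thetaM_re]

/-- A point of largest norm in a subset of `X` carrying all its Jensen measures belongs to `O_X`. -/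
theorem mem_Oset_of_isMaxOn_norm {n : ℕ} {X K : Set (En n)} (hKX : K ⊆ X) {w : En n} (hw : w ∈ K)
    (hmax : IsMaxOn (fun x => ‖x‖) K w)
    (hK : ∀ μ : Measure (En n), IsJensen X w μ → ∀ᵐ x ∂μ, x ∈ K) : w ∈ Oset X := by
  refine ⟨hKX hw, fun μ hμ => ?_⟩
  have := hμ.1
  have hcont : Continuous fun x : En n => ((inner ℂ w x).re : EReal) :=
    continuous_coe_real_ereal.comp (by fun_prop)
  have hww : (inner ℂ w w).re = ‖w‖ ^ 2 := inner_self_eq_norm_sq (𝕜 := ℂ) w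
  have hae : ∀ᵐ x ∂μ, ((inner ℂ w x).re : EReal) = ((‖w‖ ^ 2 : ℝ) : EReal) := by
    refine ae_eq_of_le_eint ?_ ?_ fun c => ?_
    · filter_upwards [hK μ hμ] with x hx
      have h1 : (inner ℂ w x).re ≤ ‖w‖ * ‖x‖ := re_inner_le_norm (𝕜 := ℂ) w x
      have h2 : ‖x‖ ≤ ‖w‖ := hmax hx
      exact EReal.coe_le_coe_iff.mpr (by nlinarith [norm_nonneg w])
    · have h := hμ.2.2 Set.univ isOpen_univ (subset_univ _) _ hcont.continuousOn
        (pshOnE_re_inner w)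
      rwa [hww] at h
    · exact (isOpen_lt hcont continuous_const).measurableSet.nullMeasurableSet
  have hpt : ∀ᵐ x ∂μ, x = w := by
    filter_upwards [hK μ hμ, hae] with x hx hxw
    have h1 : (inner ℂ w x).re = ‖w‖ ^ 2 := EReal.coe_eq_coe_iff.mp hxw
    have h2 : ‖x‖ ≤ ‖w‖ := hmax hx
    have h3 : ‖w - x‖ ^ 2 = ‖w‖ ^ 2 - 2 * (inner ℂ w x).re + ‖x‖ ^ 2 :=
      norm_sub_sq (𝕜 := ℂ) w x
    have h4 : ‖w - x‖ ^ 2 ≤ 0 := by nlinarith [norm_nonneg x]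
    have h5 : ‖w - x‖ = 0 := pow_eq_zero_iff two_ne_zero |>.mp (le_antisymm h4 (sq_nonneg _))
    exact (sub_eq_zero.mp (norm_eq_zero.mp h5)).symm
  have h := Measure.map_congr (mβ := borel (En n)) (f := id) (g := fun _ => w) hpt
  rwa [Measure.map_id, Measure.map_const, measure_univ, one_smul] at h

/-- Theorem 4.3 (weak maximum principle). -/
theorem stmt_8 {n : ℕ} (X : Set (En n)) (hX : IsCompact X)
    (u : En n → EReal) (hu : PSHe X u) (z : En n) (hz : z ∈ X) :
    u z ≤ ⨆ w ∈ Bset X, u w := by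
  obtain ⟨m, hmX, hm⟩ := hu.1.exists_isMaxOn ⟨z, hz⟩ hX
  rcases eq_or_ne (u m) ⊥ with hbot | hbot
  · exact (hm hz).trans (hbot ▸ bot_le)
  lift u m to ℝ using ⟨(hu.2.1 m hmX).ne, hbot⟩ with M hM
  set K := X ∩ u ⁻¹' Ici (M : EReal)
  have hKc : IsCompact K := hu.1.isCompact_inter_preimage_Ici hX _
  obtain ⟨w, hwK, hw⟩ := hKc.exists_isMaxOn ⟨m, hmX, hM.le⟩ continuous_norm.continuousOn
  have hwO : w ∈ Oset X := by
    refine mem_Oset_of_isMaxOn_norm inter_subset_left hwK hw fun μ hμ => ?_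
    have := hμ.1
    have hX' : ∀ᵐ x ∂μ, x ∈ X := mem_ae_iff.mpr hμ.2.1
    have hae : ∀ᵐ x ∂μ, u x = M := by
      refine ae_eq_of_le_eint ?_ (hwK.2.trans (hu.2.2 w hwK.1 μ hμ)) fun c => ?_
      · filter_upwards [hX'] with x hx
        exact hM ▸ hm hx
      · obtain ⟨V, hV, hVX⟩ := upperSemicontinuousOn_iff_preimage_Iio.mp hu.1 (c : EReal)
        have hms : MeasurableSet (X ∩ V) := hX.isClosed.measurableSet.inter hV.measurableSet
        rw [← hVX] at hms
        refine hms.nullMeasurableSet.congr ?_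
        filter_upwards [hX'] with x hx
        exact propext ⟨fun h => h.2, fun h => ⟨hx, h⟩⟩
    filter_upwards [hX', hae] with x hx hxM
    exact ⟨hx, hxM.ge⟩
  calc u z ≤ M := hM ▸ hm hz
    _ ≤ u w := hwK.2
    _ ≤ ⨆ w ∈ Bset X, u w := le_iSup₂_of_le w (subset_closure hwO) le_rfl
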